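/- Let M be a simple matricube of rank r or r + 1 on the hypercube [r]^d with rank function ρ, and let P_M be the dot array on [r]^d with a dot at every flat a ≠ (r, …, r) of M and, in addition, a dot at (r, …, r) in case the rank of M equals r. Then for every x ∈ [r]^d and every i ∈ {1, …, d}, one has rank_i(P_M[x]) = r + 1 − ρ(x). -/

import Mathlib

namespace Matricube

variable {d : ℕ}

/-- Membership in the hypercuboid `C(r)` of width `r`. -/
def mem (r x : Fin d → ℕ) : Prop := ∀ i, x i ≤ r i

/-- The `i`-th standard unit vector `eᵢ`. -/
def e (d : ℕ) (i : Fin d) : Fin d → ℕ := fun j => if j = i then 1 else 0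

/-- The point `t · eᵢ` of the hypercuboid. -/
def unit (d : ℕ) (i : Fin d) (t : ℕ) : Fin d → ℕ := fun j => if j = i then t else 0

/-- Submodularity of a function on the hypercuboid `C(r)`. -/
def Submodular (r : Fin d → ℕ) (f : (Fin d → ℕ) → ℤ) : Prop :=
  ∀ x y : Fin d → ℕ, mem r x → mem r y → f (x ⊔ y) + f (x ⊓ y) ≤ f x + f y

/-- Axioms (R1)-(R2)-(R3) for the rank function of a matricube on `C(r)`. -/
def IsRankFunction (r : Fin d → ℕ) (ρ : (Fin d → ℕ) → ℤ) : Prop :=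
  (ρ 0 = 0 ∧ ∀ i : Fin d, ∀ t : ℕ, 1 ≤ t → t ≤ r i →
      ρ (unit d i t) - ρ (unit d i (t - 1)) ≤ 1) ∧
  (∀ x y : Fin d → ℕ, mem r x → mem r y → x ≤ y → ρ x ≤ ρ y) ∧
  Submodular r ρ

/-- Axiom (R1*): the matricube is simple. -/
def IsSimple (r : Fin d → ℕ) (ρ : (Fin d → ℕ) → ℤ) : Prop :=
  ∀ i : Fin d, 0 < r i ∧ ∀ t : ℕ, t ≤ r i → ρ (unit d i t) = (t : ℤ)

/-- A flat of the matricube given by the rank function `ρ` on `C(r)`. -/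
def IsFlat (r : Fin d → ℕ) (ρ : (Fin d → ℕ) → ℤ) (a : Fin d → ℕ) : Prop :=
  mem r a ∧ ∀ i : Fin d, mem r (a + e d i) → ρ (a + e d i) = ρ a + 1

/-- The set of flats of the matricube given by `ρ`. -/
def flats (r : Fin d → ℕ) (ρ : (Fin d → ℕ) → ℤ) : Set (Fin d → ℕ) :=
  {a | IsFlat r ρ a}

/-- `CoversIn S a b` : `b` covers `a` in the poset `S`. -/
def CoversIn (S : Set (Fin d → ℕ)) (a b : Fin d → ℕ) : Prop :=
  a ∈ S ∧ b ∈ S ∧ a < b ∧ ∀ z ∈ S, ¬(a < z ∧ z < b)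

/-- The rank function of the dual matricube. -/
def dualRank (r : Fin d → ℕ) (ρ : (Fin d → ℕ) → ℤ) : (Fin d → ℕ) → ℤ :=
  fun x => (∑ i, (x i : ℤ)) + ρ (r - x) - ρ r

/-- Join-closure of a set: joins of nonempty (finite) families of its elements. -/
def joinClosure (A : Set (Fin d → ℕ)) : Set (Fin d → ℕ) :=
  {x | ∃ S : Finset (Fin d → ℕ), S.Nonempty ∧ ↑S ⊆ A ∧ x = S.sup id}

/-- `a` is join-irreducible in `A` : `a` is not the join of any set of elements of `A \ {a}`. -/
def JoinIrredIn (A : Set (Fin d → ℕ)) (a : Fin d → ℕ) : Prop :=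
  ∀ S : Finset (Fin d → ℕ), S.Nonempty → ↑S ⊆ A \ {a} → S.sup id ≠ a

/-- The set of circuits of the matricube given by `ρ` on `C(r)`: the nonzero
join-irreducible elements of `CC = {r - a : a a flat of the dual matricube}`. -/
def circuits (r : Fin d → ℕ) (ρ : (Fin d → ℕ) → ℤ) : Set (Fin d → ℕ) :=
  {c | c ∈ (fun a => r - a) '' flats r (dualRank r ρ) ∧ c ≠ 0 ∧
    JoinIrredIn ((fun a => r - a) '' flats r (dualRank r ρ)) c}

/-- An independent of the matricube given by `ρ` on `C(r)`. -/
def IsIndep (r : Fin d → ℕ) (ρ : (Fin d → ℕ) → ℤ) (a : Fin d → ℕ) : Prop :=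
  mem r a ∧ ∀ i : Fin d, 1 ≤ a i → ρ (a - e d i) = ρ a - 1

/-- The set of independents of the matricube given by `ρ`. -/
def indeps (r : Fin d → ℕ) (ρ : (Fin d → ℕ) → ℤ) : Set (Fin d → ℕ) :=
  {a | IsIndep r ρ a}

/-- `b` is the removal of `i` in `a` (in `J`): `b ∈ J` differs from `a` only in the `i`-th
coordinate, `b i < a i`, and `b` has the largest `i`-th coordinate among such elements. -/
def IsRemovalAt (J : Set (Fin d → ℕ)) (a : Fin d → ℕ) (i : Fin d) (b : Fin d → ℕ) : Prop :=
  b ∈ J ∧ b i < a i ∧ (∀ j : Fin d, j ≠ i → b j = a j) ∧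
  ∀ c ∈ J, c i < a i → (∀ j : Fin d, j ≠ i → c j = a j) → c i ≤ b i

/-- `b` is a removal of `a` in `J`. -/
def IsRemoval (J : Set (Fin d → ℕ)) (a b : Fin d → ℕ) : Prop :=
  ∃ i : Fin d, IsRemovalAt J a i b

/-- Removals exist in `J`. -/
def RemovalsExist (J : Set (Fin d → ℕ)) : Prop :=
  ∀ a ∈ J, ∀ i : Fin d, 1 ≤ a i → ∃ b, IsRemovalAt J a i b

/-- `a` can be reduced to `0` by a sequence of `m` removals in `J`. -/
def ReducesTo (J : Set (Fin d → ℕ)) (a : Fin d → ℕ) (m : ℕ) : Prop :=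
  ∃ c : ℕ → (Fin d → ℕ), c 0 = a ∧ c m = 0 ∧ ∀ k, k < m → IsRemoval J (c k) (c (k + 1))

/-- `J` is orderable: removals exist and all sequences of removals reducing a given
element to `0` have the same length. -/
def Orderable (J : Set (Fin d → ℕ)) : Prop :=
  RemovalsExist J ∧
  ∀ a ∈ J, ∀ m₁ m₂ : ℕ, ReducesTo J a m₁ → ReducesTo J a m₂ → m₁ = m₂

/-- Axiom (I1) for independents. -/
def AxiomI1 (J : Set (Fin d → ℕ)) : Prop :=
  RemovalsExist J ∧
  ∀ p ∈ J, ∀ i j : Fin d, ∀ bi bj : Fin d → ℕ,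
    IsRemovalAt J p i bi → IsRemovalAt J p j bj →
    bi ⊓ bj ∈ J ∧
    {c ∈ J | bi ⊓ bj ≤ c ∧ c ≤ bi}.ncard = {c ∈ J | bi ⊓ bj ≤ c ∧ c ≤ bj}.ncard

/-- Axiom (I2) for independents, relative to a size function `sz`. -/
def AxiomI2 (J : Set (Fin d → ℕ)) (sz : (Fin d → ℕ) → ℕ) : Prop :=
  (∀ a ∈ J, ∀ b ∈ J, a < b → sz a < sz b) ∧
  ∀ a ∈ J, ∀ b ∈ J, sz a < sz b → 2 ≤ {k : Fin d | a k < b k}.ncard →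
    ∃ c ∈ J, c ≤ a ⊔ b ∧ sz a < sz c ∧ ∃ i : Fin d, a i < b i ∧ c i < b i

/-- `P` is a dot array on the hypercube `[r]^d`. -/
def IsDotArray (r : ℕ) (P : Set (Fin d → ℕ)) : Prop := ∀ x ∈ P, ∀ i, x i ≤ r

/-- `rank_j (P[a])`: the number of values `t` such that the upper principal subarray
`P[a]` contains a dot whose `j`-th coordinate equals `t`. -/
noncomputable def arrayRank (P : Set (Fin d → ℕ)) (a : Fin d → ℕ) (j : Fin d) : ℕ :=
  {t : ℕ | ∃ y ∈ P, a ≤ y ∧ y j = t}.ncard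

/-- `x` is a redundant position in the dot array `P`: `x` is the meet of at least two dotted
positions `≠ x`, each having at least one coordinate in common with `x`. -/
def Redundant (P : Set (Fin d → ℕ)) (x : Fin d → ℕ) : Prop :=
  ∃ S : Finset (Fin d → ℕ), 2 ≤ S.card ∧ ↑S ⊆ P \ {x} ∧
    (∀ y ∈ S, ∃ i, y i = x i) ∧ (∀ y ∈ S, x ≤ y) ∧ ∀ z : Fin d → ℕ, (∀ y ∈ S, z ≤ y) → z ≤ x

/-- A permutation array of width `r` and dimension `d`: a totally rankable dot array on
`[r]^d` of rank `r + 1` with no redundant dots. -/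
def IsPermutationArray (r : ℕ) (P : Set (Fin d → ℕ)) : Prop :=
  IsDotArray r P ∧
  (∀ a : Fin d → ℕ, (∀ i, a i ≤ r) → ∀ j j' : Fin d, arrayRank P a j = arrayRank P a j') ∧
  (∀ j : Fin d, arrayRank P 0 j = r + 1) ∧
  (∀ x ∈ P, ¬Redundant P x)

/-- An increasing path `c 0 = 0, …, c m = a` in `C(r)`, with step directions `ℓ`. -/
def IncPath (r : Fin d → ℕ) (c : ℕ → Fin d → ℕ) (ℓ : ℕ → Fin d) (m : ℕ)
    (a : Fin d → ℕ) : Prop :=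
  c 0 = 0 ∧ c m = a ∧ ∀ j, j < m → c (j + 1) = c j + e d (ℓ j) ∧ mem r (c (j + 1))

theorem mem_update {r : ℕ} {x : Fin d → ℕ} (hx : ∀ i, x i ≤ r) (i : Fin d) {t : ℕ}
    (ht : t ≤ r) : mem (fun _ => r) (Function.update x i t) := by
  intro j
  by_cases hj : j = i
  · subst hj; simpa using ht
  · simpa [hj] using hx j

theorem mem_add_e {r y : Fin d → ℕ} (hy : mem r y) {i : Fin d} (hi : y i < r i) :
    mem r (y + e d i) := by
  intro j
  by_cases hj : j = i
  · subst hj; simpa [e] using hi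
  · simpa [e, hj] using hy j

theorem lt_of_mem_add_e {r y : Fin d → ℕ} {i : Fin d} (h : mem r (y + e d i)) : y i < r i := by
  simpa [e] using h i

/-- The marginal of a rank function in a direction is antitone, as long as the coordinate in that
direction is fixed. -/
theorem IsRankFunction.marginal_le {r : Fin d → ℕ} {ρ : (Fin d → ℕ) → ℤ}
    (h : IsRankFunction r ρ) {x y : Fin d → ℕ} (hxy : x ≤ y) {i : Fin d} (hi : x i = y i)
    (hy : mem r (y + e d i)) : ρ (y + e d i) - ρ y ≤ ρ (x + e d i) - ρ x := by
  have hy' : mem r y := fun j => (Nat.le_add_right _ _).trans (hy j)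
  have hx' : mem r (x + e d i) := fun j => (Nat.add_le_add_right (hxy j) _).trans (hy j)
  have key := h.2.2 y (x + e d i) hy' hx'
  have hsup : y ⊔ (x + e d i) = y + e d i := by
    funext j
    have := hxy j
    by_cases hj : j = i
    · subst hj; simp [e, hi]
    · simpa [e, hj] using this
  have hinf : y ⊓ (x + e d i) = x := by
    funext j
    have := hxy j
    by_cases hj : j = i
    · subst hj; simp [e, hi]
    · simpa [e, hj] using this
  rw [hsup, hinf] at key
  linarith

theorem IsRankFunction.add_e_le {r : Fin d → ℕ} {ρ : (Fin d → ℕ) → ℤ}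
    (h : IsRankFunction r ρ) {y : Fin d → ℕ} {i : Fin d} (hy : mem r (y + e d i)) :
    ρ (y + e d i) ≤ ρ y + 1 := by
  have hle : unit d i (y i) ≤ y := by
    intro j
    by_cases hj : j = i
    · subst hj; simp [unit]
    · simp [unit, hj]
  have h1 := h.marginal_le hle (i := i) (by simp [unit]) hy
  have h2 := h.1.2 i (y i + 1) (by omega) (lt_of_mem_add_e hy)
  have h3 : unit d i (y i) + e d i = unit d i (y i + 1) := by
    funext j
    by_cases hj : j = i <;> simp [unit, e, hj]
  rw [h3] at h1
  simp only [Nat.add_sub_cancel] at h2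
  linarith

/-- Every point lies below a flat of the same rank. -/
theorem IsRankFunction.exists_flat {r : Fin d → ℕ} {ρ : (Fin d → ℕ) → ℤ}
    (h : IsRankFunction r ρ) {x : Fin d → ℕ} (hx : mem r x) :
    ∃ y, IsFlat r ρ y ∧ x ≤ y ∧ ρ y = ρ x := by
  have hfin : {y | mem r y ∧ ρ y = ρ x}.Finite :=
    (Set.finite_Iic r).subset fun y hy => hy.1
  obtain ⟨y, hxy, hy⟩ := hfin.exists_le_maximal (a := x) ⟨hx, rfl⟩
  refine ⟨y, ⟨hy.prop.1, fun i hi => ?_⟩, hxy, hy.prop.2⟩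
  have hle : y ≤ y + e d i := fun j => Nat.le_add_right _ _
  have h1 := h.add_e_le hi
  have h2 := h.2.1 _ _ hy.prop.1 hi hle
  have h3 : ρ (y + e d i) ≠ ρ y := fun heq => by
    have := hy.le_of_ge ⟨hi, heq.trans hy.prop.2⟩ hle i
    simp [e] at this
  omega

theorem IsFlat.rank_lt {r : Fin d → ℕ} {ρ : (Fin d → ℕ) → ℤ} (h : IsRankFunction r ρ)
    {y : Fin d → ℕ} (hy : IsFlat r ρ y) (hne : y ≠ r) : ρ y < ρ r := by
  obtain ⟨j, hj⟩ : ∃ j, y j < r j := by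
    by_contra! hc
    exact hne (le_antisymm hy.1 hc)
  have hm := mem_add_e hy.1 hj
  have h1 := hy.2 j hm
  have h2 := h.2.1 _ r hm (fun _ => le_rfl) hm
  omega

/-- An integer function with increments `0` and `1` climbs by the number of its increasing
steps. -/
theorem card_filter_increments (g : ℕ → ℤ) {a b : ℕ} (hab : a ≤ b)
    (hg : ∀ t, a ≤ t → t < b → g (t + 1) = g t ∨ g (t + 1) = g t + 1) :
    (((Finset.Ico a b).filter fun t => g (t + 1) = g t + 1).card : ℤ) = g b - g a := by
  rw [← Finset.sum_Ico_sub g hab, Finset.card_filter, Nat.cast_sum]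
  refine Finset.sum_congr rfl fun t ht => ?_
  rw [Finset.mem_Ico] at ht
  rcases hg t ht.1 ht.2 with h | h <;> simp [h]

theorem update_add_e (x : Fin d → ℕ) (i : Fin d) (t : ℕ) :
    Function.update x i t + e d i = Function.update x i (t + 1) := by
  funext j
  by_cases hj : j = i
  · subst hj; simp [e]
  · simp [e, hj]

/-- A flat above `x` with `i`-th coordinate `t < r` exists exactly when the rank increases from
`t` to `t + 1` along the line through `x` in direction `i`. -/
theorem IsRankFunction.exists_flat_coord_iff {r : ℕ} {ρ : (Fin d → ℕ) → ℤ}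
    (h : IsRankFunction (fun _ => r) ρ) {x : Fin d → ℕ} (hx : ∀ i, x i ≤ r) {i : Fin d} {t : ℕ}
    (hxt : x i ≤ t) (ht : t < r) :
    (∃ y, IsFlat (fun _ => r) ρ y ∧ x ≤ y ∧ y i = t) ↔
      ρ (Function.update x i (t + 1)) = ρ (Function.update x i t) + 1 := by
  have hm := mem_update hx i ht.le
  have hm' := mem_update hx i (show t + 1 ≤ r from ht)
  constructor
  · rintro ⟨y, hy, hxy, rfl⟩
    have hym : mem (fun _ => r) (y + e d i) := mem_add_e hy.1 ht
    have hle : Function.update x i (y i) ≤ y := by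
      rw [update_le_iff]
      exact ⟨le_rfl, fun j _ => hxy j⟩
    have h1 := h.marginal_le hle (i := i) (by simp) hym
    have h2 := hy.2 i hym
    have h3 : ρ (Function.update x i (y i) + e d i) ≤ _ :=
      h.add_e_le (by rw [update_add_e]; exact hm')
    rw [update_add_e] at h1 h3
    omega
  · intro hinc
    obtain ⟨y, hy, hxy, hρ⟩ := h.exists_flat hm
    rw [update_le_iff] at hxy
    refine ⟨y, hy, fun j => ?_, le_antisymm ?_ hxy.1⟩
    · by_cases hj : j = i
      · subst hj; exact hxt.trans hxy.1
      · exact hxy.2 j hj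
    · by_contra! hlt
      have hle : Function.update x i (t + 1) ≤ y := by
        rw [update_le_iff]
        exact ⟨hlt, hxy.2⟩
      have := h.2.1 _ _ hm' hy.1 hle
      omega

/-- For a simple matricube of rank `r` or `r + 1` on `[r]^d`, the dot array `P_M` with a dot
at every flat `≠ (r, …, r)` (and also at `(r, …, r)` if the rank is `r`) satisfies
`rank_i(P_M[x]) = r + 1 − ρ(x)` for every `x` and every direction `i`. -/
theorem dot_array_rank_eq (d r : ℕ) (hd : 0 < d) (hr : 0 < r)
    (ρ : (Fin d → ℕ) → ℤ)
    (h : IsRankFunction (fun _ => r) ρ) (hs : IsSimple (fun _ => r) ρ)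
    (hrank : ρ (fun _ => r) = r ∨ ρ (fun _ => r) = r + 1)
    (x : Fin d → ℕ) (hx : ∀ i, x i ≤ r) (i : Fin d) :
    (arrayRank ({a | IsFlat (fun _ => r) ρ a ∧ a ≠ fun _ => r} ∪
        {a | a = (fun _ => r : Fin d → ℕ) ∧ ρ (fun _ => r) = r}) x i : ℤ) =
      (r : ℤ) + 1 - ρ x := by
  set P : Set (Fin d → ℕ) := {a | IsFlat (fun _ => r) ρ a ∧ a ≠ fun _ => r} ∪
    {a | a = (fun _ => r : Fin d → ℕ) ∧ ρ (fun _ => r) = r} with hP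
  let g : ℕ → ℤ := fun t => if t ≤ r then ρ (Function.update x i t) else r + 1
  have hgle : ∀ t, t ≤ r → g t = ρ (Function.update x i t) := fun t ht => if_pos ht
  have hgr : g (r + 1) = r + 1 := if_neg (by omega)
  have hgx : g (x i) = ρ x := by rw [hgle _ (hx i), Function.update_eq_self]
  have hmr := mem_update hx i (le_refl r)
  have hlow : (r : ℤ) ≤ ρ (Function.update x i r) := by
    rw [← (hs i).2 r le_rfl]
    refine h.2.1 _ _ (fun j => ?_) hmr (fun j => ?_) <;> by_cases hj : j = i <;>
      simp [unit, hj]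
  have hupp : ρ (Function.update x i r) ≤ ρ (fun _ => r) :=
    h.2.1 _ _ hmr (fun _ => le_rfl) hmr
  have hstep : ∀ t, x i ≤ t → t < r + 1 → g (t + 1) = g t ∨ g (t + 1) = g t + 1 := by
    intro t _ ht
    rcases Nat.lt_succ_iff_lt_or_eq.mp ht with ht | rfl
    · have hm' := mem_update hx i (show t + 1 ≤ r from ht)
      rw [hgle t ht.le, hgle (t + 1) ht]
      have h1 := h.add_e_le (y := Function.update x i t) (i := i)
        (by rw [update_add_e]; exact hm')
      rw [update_add_e] at h1
      have h2 := h.2.1 _ _ (mem_update hx i ht.le) hm'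
        (update_le_update_iff.mpr ⟨Nat.le_add_right t 1, fun _ _ => le_rfl⟩)
      omega
    · rw [hgr, hgle t le_rfl]
      omega
  have hset : {t : ℕ | ∃ y ∈ P, x ≤ y ∧ y i = t} =
      ((Finset.Ico (x i) (r + 1)).filter fun t => g (t + 1) = g t + 1 : Finset ℕ) := by
    ext t
    simp only [Set.mem_ofPred_eq, Finset.coe_filter, Finset.mem_Ico]
    have hPmem : ∀ y ∈ P, mem (fun _ => r) y := by
      rintro y (hy | ⟨rfl, -⟩)
      · exact hy.1.1
      · exact fun _ => le_rfl
    have hrange : (∃ y ∈ P, x ≤ y ∧ y i = t) → x i ≤ t ∧ t ≤ r := by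
      rintro ⟨y, hy, hxy, rfl⟩
      exact ⟨hxy i, hPmem y hy i⟩
    by_cases hxt : x i ≤ t ∧ t ≤ r
    swap
    · exact ⟨fun hy => absurd (hrange hy) hxt, fun ht => absurd ⟨ht.1.1, by omega⟩ hxt⟩
    rw [and_iff_right (by omega : x i ≤ t ∧ t < r + 1)]
    rcases hxt.2.lt_or_eq with ht | rfl
    · rw [hgle t ht.le, hgle (t + 1) ht, ← h.exists_flat_coord_iff hx hxt.1 ht]
      constructor
      · rintro ⟨y, hy | ⟨rfl, -⟩, hxy, hyt⟩
        · exact ⟨y, hy.1, hxy, hyt⟩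
        · exact absurd hyt ht.ne'
      · rintro ⟨y, hy, hxy, rfl⟩
        exact ⟨y, Or.inl ⟨hy, fun hc => ht.ne (congrFun hc i)⟩, hxy, rfl⟩
    · rw [hgr, hgle t le_rfl]
      constructor
      · rintro ⟨y, hy | ⟨rfl, hfull⟩, hxy, hyt⟩
        · have h1 := IsFlat.rank_lt h hy.1 hy.2
          have h2 := h.2.1 (Function.update x i t) y hmr hy.1.1
            (update_le_iff.mpr ⟨hyt.ge, fun j _ => hxy j⟩)
          omega
        · omega
      · intro heq
        rcases hrank with hfull | hfull
        · exact ⟨fun _ => t, Or.inr ⟨rfl, hfull⟩, hx, rfl⟩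
        · obtain ⟨y, hy, hxy, hρ⟩ := h.exists_flat hmr
          refine ⟨y, Or.inl ⟨hy, ?_⟩, ?_, ?_⟩
          · rintro rfl
            omega
          · exact (le_update_iff.mpr ⟨hx i, fun _ _ => le_rfl⟩).trans hxy
          · exact le_antisymm (hy.1 i) (update_le_iff.mp hxy).1
  rw [arrayRank, hset, Set.ncard_coe_finset,
    card_filter_increments g ((hx i).trans (Nat.le_succ r)) hstep, hgr, hgx]

end Matricube
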